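/- Let Q be a real symmetric positive definite n×n matrix with spectral decomposition Q = U Σ Uᵀ, where U is n×n orthogonal and Σ is diagonal with strictly positive diagonal entries, and let β be a real n×m matrix with n ≥ m. Let Σ^{-1/2} Uᵀ β = U* Σ* V*ᵀ be a thin singular value decomposition (U* is n×m with U*ᵀ U* = I_m, Σ* is m×m diagonal nonnegative, V* is m×m orthogonal). Then α̂ = U Σ^{-1/2} U* V*ᵀ satisfies α̂ᵀ Q α̂ = I_m, and for every n×m real matrix α with αᵀ Q α = I_m one has tr(αᵀ β) ≤ tr(α̂ᵀ β). -/

import Mathlib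

open Matrix

/-- Matrices with orthonormal columns have columnwise inner products at most one. -/
theorem transpose_mul_apply_self_le_one {ι κ : Type*} [Fintype ι] [DecidableEq κ]
    {A B : Matrix ι κ ℝ} (hA : Aᵀ * A = 1) (hB : Bᵀ * B = 1) (j : κ) :
    (Aᵀ * B) j j ≤ 1 := by
  have hAj : ∑ k, A k j * A k j = 1 := by
    simpa [Matrix.mul_apply] using congrFun (congrFun hA j) j
  have hBj : ∑ k, B k j * B k j = 1 := by
    simpa [Matrix.mul_apply] using congrFun (congrFun hB j) j
  have h : 0 ≤ ∑ k, (A k j - B k j) ^ 2 := Finset.sum_nonneg fun k _ => sq_nonneg _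
  have hexp : ∑ k, (A k j - B k j) ^ 2 =
      ∑ k, A k j * A k j + ∑ k, B k j * B k j - 2 * ∑ k, A k j * B k j := by
    rw [Finset.mul_sum, ← Finset.sum_add_distrib, ← Finset.sum_sub_distrib]
    exact Finset.sum_congr rfl fun k _ => by ring
  simp only [Matrix.mul_apply, Matrix.transpose_apply]
  linarith

/-- Over pairs of matrices with orthonormal columns, the trace of `Aᵀ * B` weighted by a
nonnegative diagonal matrix is at most the sum of the weights. -/
theorem trace_transpose_mul_mul_diagonal_le {ι κ : Type*} [Fintype ι] [Fintype κ]
    [DecidableEq κ] {A B : Matrix ι κ ℝ} (hA : Aᵀ * A = 1) (hB : Bᵀ * B = 1)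
    {s : κ → ℝ} (hs : ∀ j, 0 ≤ s j) :
    (Aᵀ * B * Matrix.diagonal s).trace ≤ ∑ j, s j := by
  simp only [Matrix.trace, Matrix.diag_apply, Matrix.mul_diagonal]
  exact Finset.sum_le_sum fun j _ =>
    mul_le_of_le_one_left (hs j) (transpose_mul_apply_self_le_one hA hB j)

/-- Generalized Procrustes-type problem with constraint `αᵀ Q α = I`. -/
theorem stmt_2 (n m : ℕ) (hnm : m ≤ n)
    (Q U : Matrix (Fin n) (Fin n) ℝ) (σ : Fin n → ℝ)
    (hQsym : Qᵀ = Q) (hQpd : Q.PosDef)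
    (hU₁ : Uᵀ * U = 1) (hU₂ : U * Uᵀ = 1)
    (hσ : ∀ i, 0 < σ i)
    (hQ : Q = U * Matrix.diagonal σ * Uᵀ)
    (β Ustar : Matrix (Fin n) (Fin m) ℝ) (σstar : Fin m → ℝ)
    (Vstar : Matrix (Fin m) (Fin m) ℝ)
    (hUstar : Ustarᵀ * Ustar = 1) (hσstar : ∀ i, 0 ≤ σstar i)
    (hVstar₁ : Vstarᵀ * Vstar = 1) (hVstar₂ : Vstar * Vstarᵀ = 1)
    (hSVD : Matrix.diagonal (fun i => (Real.sqrt (σ i))⁻¹) * Uᵀ * β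
      = Ustar * Matrix.diagonal σstar * Vstarᵀ) :
    ((U * Matrix.diagonal (fun i => (Real.sqrt (σ i))⁻¹) * Ustar * Vstarᵀ)ᵀ * Q *
      (U * Matrix.diagonal (fun i => (Real.sqrt (σ i))⁻¹) * Ustar * Vstarᵀ) = 1) ∧
    ∀ α : Matrix (Fin n) (Fin m) ℝ, αᵀ * Q * α = 1 →
      (αᵀ * β).trace ≤
        ((U * Matrix.diagonal (fun i => (Real.sqrt (σ i))⁻¹) * Ustar * Vstarᵀ)ᵀ * β).trace := by
  have hsq : ∀ i, Real.sqrt (σ i) ≠ 0 := fun i => (Real.sqrt_pos.2 (hσ i)).ne'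
  set D : Matrix (Fin n) (Fin n) ℝ := Matrix.diagonal fun i => (Real.sqrt (σ i))⁻¹ with hD
  set S : Matrix (Fin n) (Fin n) ℝ := Matrix.diagonal fun i => Real.sqrt (σ i) with hS
  have hDt : Dᵀ = D := Matrix.diagonal_transpose _
  have hSt : Sᵀ = S := Matrix.diagonal_transpose _
  have hSD : S * D = 1 := by simp [hS, hD, hsq]
  have hDS : D * S = 1 := by simp [hS, hD, hsq]
  have hSS : Matrix.diagonal σ = S * S := by simp [hS, fun i => Real.mul_self_sqrt (hσ i).le]
  rw [hSS] at hQ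
  constructor
  · calc (U * D * Ustar * Vstarᵀ)ᵀ * Q * (U * D * Ustar * Vstarᵀ)
        = Vstar * (Ustarᵀ * (D * ((Uᵀ * U) * (S * (S * ((Uᵀ * U) * (D * (Ustar * Vstarᵀ)))))))) := by
          simp only [hQ, Matrix.transpose_mul, Matrix.transpose_transpose, hDt, Matrix.mul_assoc]
      _ = Vstar * (Ustarᵀ * ((D * S) * ((S * D) * (Ustar * Vstarᵀ)))) := by
          simp only [hU₁, Matrix.one_mul, Matrix.mul_assoc]
      _ = Vstar * ((Ustarᵀ * Ustar) * Vstarᵀ) := by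
          simp only [hDS, hSD, Matrix.one_mul, Matrix.mul_assoc]
      _ = 1 := by rw [hUstar, Matrix.one_mul, hVstar₂]
  · intro α hα
    have hβ : β = U * S * (Ustar * Matrix.diagonal σstar * Vstarᵀ) := by
      calc β = U * ((S * D) * (Uᵀ * β)) := by
            rw [hSD, Matrix.one_mul, ← Matrix.mul_assoc, hU₂, Matrix.one_mul]
        _ = U * S * (D * Uᵀ * β) := by simp only [Matrix.mul_assoc]
        _ = _ := by rw [hSVD]
    have hγ : (S * Uᵀ * α * Vstar)ᵀ * (S * Uᵀ * α * Vstar) = 1 := by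
      calc (S * Uᵀ * α * Vstar)ᵀ * (S * Uᵀ * α * Vstar)
          = Vstarᵀ * (αᵀ * Q * α) * Vstar := by
            simp only [hQ, Matrix.transpose_mul, Matrix.transpose_transpose, hSt,
              Matrix.mul_assoc]
        _ = 1 := by rw [hα, Matrix.mul_one, hVstar₁]
    have hleft : (αᵀ * β).trace =
        ((S * Uᵀ * α * Vstar)ᵀ * Ustar * Matrix.diagonal σstar).trace := by
      calc (αᵀ * β).trace
          = ((αᵀ * U * S * Ustar * Matrix.diagonal σstar) * Vstarᵀ).trace := by
            rw [hβ]; simp only [Matrix.mul_assoc]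
        _ = _ := by
            rw [Matrix.trace_mul_comm]
            simp only [Matrix.transpose_mul, Matrix.transpose_transpose, hSt, Matrix.mul_assoc]
    have hright : ((U * D * Ustar * Vstarᵀ)ᵀ * β).trace = ∑ j, σstar j := by
      calc ((U * D * Ustar * Vstarᵀ)ᵀ * β).trace
          = (Vstar * (Ustarᵀ * (D * Uᵀ * β))).trace := by
            simp only [Matrix.transpose_mul, Matrix.transpose_transpose, hDt, Matrix.mul_assoc]
        _ = (Vstar * ((Ustarᵀ * Ustar) * (Matrix.diagonal σstar * Vstarᵀ))).trace := by
            rw [hSVD]; simp only [Matrix.mul_assoc]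
        _ = (Matrix.diagonal σstar).trace := by
            rw [hUstar, Matrix.one_mul, Matrix.trace_mul_comm, Matrix.mul_assoc, hVstar₁,
              Matrix.mul_one]
        _ = ∑ j, σstar j := Matrix.trace_diagonal _
    rw [hleft, hright]
    exact trace_transpose_mul_mul_diagonal_le hγ hUstar hσstar
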